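/- (Two incompatible partitions of the Schmidt coefficients.) Let (ψ, (P_x^a), (Q_y^b)) be any finite-dimensional strategy inducing the ideal correlation p*, and let Schmidt(ψ) denote its multiset of nonzero Schmidt coefficients. Then there exist multisets S₀, S₁, S₂ of positive real numbers with S₂ nonempty such that: Schmidt(ψ) = S₀ + S₁ (multiset sum); S₁ = S₀.map(λ ↦ α·λ); and S₀ = S₂ + S₁.map(λ ↦ α·λ). (Consequently |S₀| = |S₂| + |S₁| = |S₂| + |S₀|, which is impossible for finite multisets with S₂ nonempty.) -/

import Mathlib

open Matrix Kronecker

noncomputable section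

namespace Sep

/-- Pauli `σz`. -/
def sz : Matrix (Fin 2) (Fin 2) ℝ := !![1, 0; 0, -1]

/-- Pauli `σx`. -/
def sx : Matrix (Fin 2) (Fin 2) ℝ := !![0, 1; 1, 0]

/-- `μ = arctan (sin 2θ)` where `θ = arctan α`. -/
def mu (α : ℝ) : ℝ := Real.arctan (Real.sin (2 * Real.arctan α))

/-- The tilted Pauli `σαz`. -/
def saz (α : ℝ) : Matrix (Fin 2) (Fin 2) ℝ :=
  Real.cos (mu α) • sz + Real.sin (mu α) • sx

/-- The tilted Pauli `σαx`. -/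
def sax (α : ℝ) : Matrix (Fin 2) (Fin 2) ℝ :=
  Real.cos (mu α) • sz - Real.sin (mu α) • sx

/-- Orthogonal projection onto the `+1`-eigenspace of a symmetric involution `O`
(with eigenvalues `+1` and `-1`): `O⁺ = (I + O)/2`. -/
def pl (O : Matrix (Fin 2) (Fin 2) ℝ) : Matrix (Fin 2) (Fin 2) ℝ := (2 : ℝ)⁻¹ • (1 + O)

/-- Orthogonal projection onto the `-1`-eigenspace: `O⁻ = (I - O)/2`. -/
def mn (O : Matrix (Fin 2) (Fin 2) ℝ) : Matrix (Fin 2) (Fin 2) ℝ := (2 : ℝ)⁻¹ • (1 - O)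

/-- Embed a `2×2` matrix `O` as an `ℕ×ℕ` matrix supported on rows/columns `f 0, f 1`,
with entry `O r s` at position `(f r, f s)`. -/
def embed (f : Fin 2 → ℕ) (O : Matrix (Fin 2) (Fin 2) ℝ) : Matrix ℕ ℕ ℝ :=
  fun i j => ∑ r : Fin 2, ∑ s : Fin 2, if i = f r ∧ j = f s then O r s else 0

/-- `ev_m(O)`: supported on `{2m, 2m+1}`. -/
def evm (m : ℕ) (O : Matrix (Fin 2) (Fin 2) ℝ) : Matrix ℕ ℕ ℝ :=
  embed (fun r => 2 * m + (r : ℕ)) O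

/-- `od_m(O)`: supported on `{2m+1, 2m+2}`. -/
def odm (m : ℕ) (O : Matrix (Fin 2) (Fin 2) ℝ) : Matrix ℕ ℕ ℝ :=
  embed (fun r => 2 * m + 1 + (r : ℕ)) O

/-- Entrywise sum `Σ_m F m` of a family of `ℕ×ℕ` matrices. -/
def sumB (F : ℕ → Matrix ℕ ℕ ℝ) : Matrix ℕ ℕ ℝ := fun i j => ∑' m, F m i j

/-- The `ℕ×ℕ` matrix with a single `1` entry at `(0,0)`. -/
def E00 : Matrix ℕ ℕ ℝ := fun i j => if i = 0 ∧ j = 0 then 1 else 0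

/-- Alice's ideal operators `A_x^a`. -/
def Aop : Fin 4 → Fin 3 → Matrix ℕ ℕ ℝ :=
  ![![sumB (fun m => evm m (pl sz)), sumB (fun m => evm m (mn sz)), 0],
    ![sumB (fun m => evm m (pl sx)), sumB (fun m => evm m (mn sx)), 0],
    ![sumB (fun m => odm m (mn sz)), sumB (fun m => odm m (pl sz)), E00],
    ![sumB (fun m => odm m (mn sx)), sumB (fun m => odm m (pl sx)), E00]]

/-- Bob's ideal operators `B_y^b`. -/
def Bop (α : ℝ) : Fin 5 → Fin 3 → Matrix ℕ ℕ ℝ :=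
  ![![sumB (fun m => evm m (pl (saz α))), sumB (fun m => evm m (mn (saz α))), 0],
    ![sumB (fun m => evm m (pl (sax α))), sumB (fun m => evm m (mn (sax α))), 0],
    ![sumB (fun m => odm m (mn (saz α))), sumB (fun m => odm m (pl (saz α))), E00],
    ![sumB (fun m => odm m (mn (sax α))), sumB (fun m => odm m (pl (sax α))), E00],
    ![Aop 0 0, Aop 0 1, Aop 0 2]]

/-- The ideal correlation `p*(a,b|x,y) = (1-α²) Σ_{i,k} α^{i+k} A_x^a(i,k) B_y^b(i,k)`. -/
def pstar (α : ℝ) (x : Fin 4) (y : Fin 5) (a b : Fin 3) : ℝ :=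
  (1 - α ^ 2) * ∑' ik : ℕ × ℕ, α ^ (ik.1 + ik.2) * Aop x a ik.1 ik.2 * Bop α y b ik.1 ik.2

/-- A finite-dimensional strategy on question sets `Fin 4`, `Fin 5` and
answer sets `Fin 3`, `Fin 3`. -/
structure Strategy (dA dB : ℕ) where
  ψ : Fin dA × Fin dB → ℂ
  P : Fin 4 → Fin 3 → Matrix (Fin dA) (Fin dA) ℂ
  Q : Fin 5 → Fin 3 → Matrix (Fin dB) (Fin dB) ℂ
  unit : ∑ p : Fin dA × Fin dB, Complex.normSq (ψ p) = 1
  P_sa : ∀ x a, (P x a)ᴴ = P x a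
  P_proj : ∀ x a, P x a * P x a = P x a
  P_complete : ∀ x, ∑ a, P x a = 1
  Q_sa : ∀ y b, (Q y b)ᴴ = Q y b
  Q_proj : ∀ y b, Q y b * Q y b = Q y b
  Q_complete : ∀ y, ∑ b, Q y b = 1

/-- Action of `P ⊗ I` on a bipartite vector. -/
def actA {dA dB : ℕ} (P : Matrix (Fin dA) (Fin dA) ℂ) (ψ : Fin dA × Fin dB → ℂ) :
    Fin dA × Fin dB → ℂ := fun p => ∑ k, P p.1 k * ψ (k, p.2)

/-- Action of `I ⊗ Q` on a bipartite vector. -/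
def actB {dA dB : ℕ} (Q : Matrix (Fin dB) (Fin dB) ℂ) (ψ : Fin dA × Fin dB → ℂ) :
    Fin dA × Fin dB → ℂ := fun p => ∑ l, Q p.2 l * ψ (p.1, l)

/-- The correlation induced by a strategy: `⟨ψ, (P_x^a ⊗ Q_y^b) ψ⟩`. -/
def induced {dA dB : ℕ} (S : Strategy dA dB) (x : Fin 4) (y : Fin 5) (a b : Fin 3) : ℂ :=
  ∑ p : Fin dA × Fin dB, (starRingEnd ℂ) (S.ψ p) * actA (S.P x a) (actB (S.Q y b) S.ψ) p

end Sep

namespace Sep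

/-- The coefficient matrix of a bipartite vector. -/
def cmat {dA dB : ℕ} (φ : Fin dA × Fin dB → ℂ) : Matrix (Fin dA) (Fin dB) ℂ :=
  Matrix.of fun i j => φ (i, j)

/-- The multiset of nonzero Schmidt coefficients of a bipartite vector `φ`:
the square roots of the nonzero eigenvalues (with multiplicity) of `M·Mᴴ`,
where `M` is the coefficient matrix of `φ`. -/
def schmidt {dA dB : ℕ} (φ : Fin dA × Fin dB → ℂ) : Multiset ℝ :=
  Multiset.map Real.sqrt
    ((Multiset.map
        (Matrix.isHermitian_mul_conjTranspose_self (cmat φ)).eigenvalues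
        Finset.univ.val).filter (fun t => t ≠ 0))

end Sep

namespace Sep

section Expectation

variable {n : Type*} [Fintype n]

/-- The real part of the expectation value `⟨φ, T φ⟩`. -/
def expect (φ : n → ℂ) : Matrix n n ℂ →ₗ[ℝ] ℝ where
  toFun T := (star φ ⬝ᵥ T *ᵥ φ).re
  map_add' T U := by simp [add_mulVec, dotProduct_add]
  map_smul' c T := by simp [smul_mulVec, dotProduct_smul]

theorem expect_conjTranspose_mul (φ : n → ℂ) (T U : Matrix n n ℂ) :
    expect φ (Tᴴ * U) = (star (T *ᵥ φ) ⬝ᵥ U *ᵥ φ).re := by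
  simp [expect, star_mulVec, dotProduct_mulVec]

open scoped ComplexOrder in
theorem expect_conjTranspose_mul_self_nonneg (φ : n → ℂ) (T : Matrix n n ℂ) :
    0 ≤ expect φ (Tᴴ * T) := by
  rw [expect_conjTranspose_mul]
  exact (Complex.nonneg_iff.mp (dotProduct_star_self_nonneg _)).1

open scoped ComplexOrder in
theorem mulVec_eq_zero_of_expect {φ : n → ℂ} {T : Matrix n n ℂ}
    (h : expect φ (Tᴴ * T) = 0) : T *ᵥ φ = 0 := by
  rw [expect_conjTranspose_mul] at h
  have h0 := Complex.nonneg_iff.mp (dotProduct_star_self_nonneg (T *ᵥ φ))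
  exact dotProduct_star_self_eq_zero.mp (Complex.ext h h0.2.symm)

theorem expect_congr {φ : n → ℂ} {T T' U U' : Matrix n n ℂ}
    (hT : T *ᵥ φ = T' *ᵥ φ) (hU : U *ᵥ φ = U' *ᵥ φ) :
    expect φ (Tᴴ * U) = expect φ (T'ᴴ * U') := by
  rw [expect_conjTranspose_mul, expect_conjTranspose_mul, hT, hU]

/-- Rigidity of the tilted CHSH inequality. -/
theorem tilted_rigidity [DecidableEq n] {φ : n → ℂ} {A₀ A₁ X Z : Matrix n n ℂ} {k s N : ℝ}
    (hA₀ : A₀ᴴ = A₀) (hA₁ : A₁ᴴ = A₁) (hX : Xᴴ = X) (hZ : Zᴴ = Z)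
    (sqA₀ : A₀ * A₀ = 1) (sqA₁ : A₁ * A₁ = 1)
    (hX₀ : X * A₀ = A₀ * X) (hX₁ : X * A₁ = A₁ * X)
    (hZ₀ : Z * A₀ = A₀ * Z) (hZ₁ : Z * A₁ = A₁ * Z)
    (hXZ : X * Z = -(Z * X)) (hsq : Z * Z + s ^ 2 • (X * X) = (1 + s ^ 2) • (1 : Matrix n n ℂ))
    (hks : k ^ 2 + s ^ 2 = 1) (hs : s ≠ 0)
    (e1 : expect φ 1 = N) (eA₀ : expect φ A₀ = k * N) (eZ : expect φ Z = k * N)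
    (eA₀Z : expect φ (A₀ * Z) = N) (eA₁X : expect φ (A₁ * X) = s * N) :
    (1 + k) • ((X * (1 - A₀)) *ᵥ φ) = s • ((A₁ * (1 + A₀)) *ᵥ φ) := by
  have r (T U V : Matrix n n ℂ) (h : T * U = V) (W) : T * (U * W) = V * W := by
    rw [← mul_assoc, h]
  have sqA₀' (W) : A₀ * (A₀ * W) = W := by rw [r _ _ _ sqA₀, one_mul]
  have sqA₁' (W) : A₁ * (A₁ * W) = W := by rw [r _ _ _ sqA₁, one_mul]
  have hX₀' (W) : X * (A₀ * W) = A₀ * (X * W) := by rw [r _ _ _ hX₀, mul_assoc]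
  have hX₁' (W) : X * (A₁ * W) = A₁ * (X * W) := by rw [r _ _ _ hX₁, mul_assoc]
  have hZ₀' (W) : Z * (A₀ * W) = A₀ * (Z * W) := by rw [r _ _ _ hZ₀, mul_assoc]
  have hZ₁' (W) : Z * (A₁ * W) = A₁ * (Z * W) := by rw [r _ _ _ hZ₁, mul_assoc]
  have hXZ' (W) : X * (Z * W) = -(Z * (X * W)) := by rw [r _ _ _ hXZ, neg_mul, mul_assoc]
  -- the sum-of-squares decomposition
  set I : Matrix n n ℂ := k • A₀ + A₀ * Z + s • (A₁ * X) with hI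
  set Y : Matrix n n ℂ := k • A₁ - s • (A₀ * X) - A₁ * Z with hY
  have hIh : Iᴴ = I := by
    simp [hI, conjTranspose_add, conjTranspose_mul, conjTranspose_smul, hA₀, hA₁, hX, hZ, hX₁, hZ₀]
  have hYh : Yᴴ = Y := by
    simp [hY, conjTranspose_sub, conjTranspose_mul, conjTranspose_smul, hA₀, hA₁, hX, hZ, hX₀, hZ₁]
  have sos : ((2 : ℝ) • 1 - I)ᴴ * ((2 : ℝ) • 1 - I) + Yᴴ * Y
      = (4 : ℝ) • ((2 : ℝ) • 1 - I) := by
    rw [conjTranspose_sub, hIh, hYh, conjTranspose_smul, conjTranspose_one, star_trivial, hI, hY]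
    simp only [mul_add, add_mul, mul_sub, sub_mul, smul_mul_assoc, mul_smul_comm, mul_assoc, sqA₀,
      sqA₁, sqA₀', sqA₁', hX₀, hX₁, hZ₀, hZ₁, hX₀', hX₁', hZ₀', hZ₁', hXZ, mul_neg, mul_one, one_mul]
    have h2 : (k ^ 2 + s ^ 2) • (1 : Matrix n n ℂ) = (1 : ℝ) • 1 := by rw [hks]
    linear_combination (norm := module) (2 : ℝ) • hsq + (2 : ℝ) • h2
  have hI0 : ((2 : ℝ) • 1 - I) *ᵥ φ = 0 := by
    apply mulVec_eq_zero_of_expect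
    have h := congrArg (expect φ) sos
    have h0 : expect φ ((2 : ℝ) • 1 - I) = 0 := by
      simp only [hI, map_sub, map_add, map_smul, smul_eq_mul, e1, eA₀, eA₀Z, eA₁X]
      linear_combination (-N) * hks
    rw [map_add, map_smul, h0, smul_zero] at h
    linarith [expect_conjTranspose_mul_self_nonneg φ ((2 : ℝ) • 1 - I),
      expect_conjTranspose_mul_self_nonneg φ Y]
  have hsX : (s • (A₁ * X)) *ᵥ φ = ((2 : ℝ) • 1 - k • A₀ - A₀ * Z) *ᵥ φ := by
    rw [← sub_eq_zero, ← sub_mulVec, ← neg_eq_zero, ← neg_mulVec, ← hI0, hI]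
    congr 1
    abel
  have eZZ : expect φ (Z * Z) = N := by
    have h := expect_congr hsX hsX
    simp only [conjTranspose_sub, conjTranspose_smul, conjTranspose_mul, conjTranspose_one,
      star_trivial, hA₀, hA₁, hX, hZ] at h
    simp only [mul_sub, sub_mul, smul_mul_assoc, mul_smul_comm, mul_assoc, sqA₀, sqA₀', sqA₁',
      hX₁, hZ₀, hX₁', hZ₀', mul_one, one_mul, map_sub, map_smul, smul_eq_mul, e1, eA₀, eZ, eA₀Z] at h
    have h2 := congrArg (expect φ) hsq
    simp only [map_add, map_smul, smul_eq_mul, e1] at h2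
    linear_combination (1 / 2 : ℝ) * h2 - (1 / 2 : ℝ) * h + (N / 2) * hks
  have hZφ : Z *ᵥ φ = A₀ *ᵥ φ := by
    rw [← sub_eq_zero, ← sub_mulVec]
    apply mulVec_eq_zero_of_expect
    rw [conjTranspose_sub, hZ, hA₀]
    simp only [mul_sub, sub_mul, hZ₀, sqA₀, map_sub, eZZ, eA₀Z, e1]
    ring
  have hZZφ : (Z * Z) *ᵥ φ = (1 : Matrix n n ℂ) *ᵥ φ := by
    rw [← mulVec_mulVec, hZφ, mulVec_mulVec, hZ₀, ← mulVec_mulVec, hZφ, mulVec_mulVec, sqA₀]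
  have hXXφ : (X * X) *ᵥ φ = (1 : Matrix n n ℂ) *ᵥ φ := by
    have h := congrArg (· *ᵥ φ) hsq
    simp only [add_mulVec, smul_mulVec, hZZφ, add_smul, one_smul, add_right_inj] at h
    exact smul_right_injective _ (pow_ne_zero 2 hs) h
  rw [← smul_mulVec, ← smul_mulVec, ← sub_eq_zero, ← sub_mulVec]
  apply mulVec_eq_zero_of_expect
  have x1 : expect φ ((X * (1 - A₀))ᴴ * (X * (1 - A₀))) = 2 * (1 - k) * N := by
    have : (X * (1 - A₀))ᴴ * (X * (1 - A₀)) = ((2 : ℝ) • (1 - A₀))ᴴ * (X * X) := by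
      simp only [conjTranspose_sub, conjTranspose_smul, conjTranspose_mul, conjTranspose_one,
        star_trivial, hA₀, hX]
      simp only [mul_sub, sub_mul, smul_mul_assoc, mul_assoc, hX₀, hX₀', sqA₀', mul_one, one_mul]
      module
    rw [this, expect_congr rfl hXXφ]
    simp only [conjTranspose_sub, conjTranspose_smul, conjTranspose_one, star_trivial, hA₀, mul_one,
      map_sub, map_smul, smul_eq_mul, e1, eA₀]
    ring
  have x2 : expect φ ((A₁ * (1 + A₀))ᴴ * (A₁ * (1 + A₀))) = 2 * (1 + k) * N := by
    simp only [conjTranspose_add, conjTranspose_mul, conjTranspose_one, hA₀, hA₁]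
    simp only [mul_add, add_mul, mul_assoc, sqA₀, sqA₁, sqA₁', mul_one, one_mul, map_add, e1, eA₀]
    ring
  have hm : (1 - A₀) *ᵥ φ = (1 - Z) *ᵥ φ := by rw [sub_mulVec, sub_mulVec, hZφ]
  have hp : (1 + A₀) *ᵥ φ = (1 + Z) *ᵥ φ := by rw [add_mulVec, add_mulVec, hZφ]
  have key (e : ℝ) (T U : Matrix n n ℂ) (hT : T *ᵥ φ = (1 - e • Z) *ᵥ φ)
      (hU : U *ᵥ φ = (1 + e • Z) *ᵥ φ) (he : e * e = 1) :
      expect φ (Tᴴ * (A₁ * X * U)) = expect φ ((2 : ℝ) • (A₁ * X) + (2 * e) • (A₁ * X * Z)) := by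
    have h1 : (A₁ * X * U) *ᵥ φ = (A₁ * X * (1 + e • Z)) *ᵥ φ := by
      rw [← mulVec_mulVec, hU, mulVec_mulVec]
    have h2 : (1 - e • Z)ᴴ * (A₁ * X * (1 + e • Z))
        = (A₁ * X)ᴴ * (1 + (2 * e) • Z + Z * Z) := by
      simp only [conjTranspose_sub, conjTranspose_smul, conjTranspose_mul, conjTranspose_one,
        star_trivial, hA₁, hX, hZ]
      simp only [mul_add, sub_mul, smul_mul_assoc, mul_smul_comm, mul_assoc, hX₁, hZ₁', hXZ, hXZ',
        mul_neg, mul_one, one_mul, smul_neg]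
      have : (e * e) • (A₁ * (Z * (Z * X))) = (1 : ℝ) • (A₁ * (Z * (Z * X))) := by rw [he]
      linear_combination (norm := module) this
    have h3 : (1 + (2 * e) • Z + Z * Z) *ᵥ φ = ((2 : ℝ) • 1 + (2 * e) • Z) *ᵥ φ := by
      simp only [add_mulVec, hZZφ, smul_mulVec]
      module
    rw [expect_congr hT h1, h2, expect_congr rfl h3]
    simp only [conjTranspose_mul, hA₁, hX, hX₁, mul_add, mul_smul_comm, mul_one]
  have k1 := key 1 (1 - A₀) (1 + A₀) (by rw [hm, one_smul]) (by rw [hp, one_smul]) (by norm_num)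
  have k2 := key (-1) (1 + A₀) (1 - A₀) (by rw [hp]; congr 1; module)
    (by rw [hm]; congr 1; module) (by norm_num)
  have c1 : (X * (1 - A₀))ᴴ * (A₁ * (1 + A₀)) = (1 - A₀)ᴴ * (A₁ * X * (1 + A₀)) := by
    rw [conjTranspose_mul, hX, mul_assoc, hX₁', mul_assoc]
  have c2 : (A₁ * (1 + A₀))ᴴ * (X * (1 - A₀)) = (1 + A₀)ᴴ * (A₁ * X * (1 - A₀)) := by
    rw [conjTranspose_mul, hA₁, mul_assoc, mul_assoc]
  have expand (T U : Matrix n n ℂ) (a b : ℝ) : expect φ ((a • T - b • U)ᴴ * (a • T - b • U))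
      = a ^ 2 * expect φ (Tᴴ * T) + b ^ 2 * expect φ (Uᴴ * U)
        - a * b * (expect φ (Tᴴ * U) + expect φ (Uᴴ * T)) := by
    simp only [conjTranspose_sub, conjTranspose_smul, star_trivial, mul_sub, sub_mul,
      smul_mul_assoc, mul_smul_comm, map_sub, map_smul, smul_eq_mul]
    ring
  rw [expand, x1, x2, c1, c2, k1, k2]
  simp only [map_add, map_smul, smul_eq_mul, eA₁X]
  linear_combination (-(2 * (1 + k) * N)) * hks

end Expectation

section Tensor

variable {dA dB : ℕ}

/-- `A ⊗ I`. -/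
abbrev opA (dB : ℕ) (A : Matrix (Fin dA) (Fin dA) ℂ) :
    Matrix (Fin dA × Fin dB) (Fin dA × Fin dB) ℂ := A ⊗ₖ 1

/-- `I ⊗ B`. -/
abbrev opB (dA : ℕ) (B : Matrix (Fin dB) (Fin dB) ℂ) :
    Matrix (Fin dA × Fin dB) (Fin dA × Fin dB) ℂ := 1 ⊗ₖ B

theorem opA_mulVec (A : Matrix (Fin dA) (Fin dA) ℂ) (φ : Fin dA × Fin dB → ℂ) :
    opA dB A *ᵥ φ = actA A φ := by
  ext p
  simp [mulVec, dotProduct, actA, Fintype.sum_prod_type, one_apply]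

theorem opB_mulVec (B : Matrix (Fin dB) (Fin dB) ℂ) (φ : Fin dA × Fin dB → ℂ) :
    opB dA B *ᵥ φ = actB B φ := by
  ext p
  simp [mulVec, dotProduct, actB, Fintype.sum_prod_type, one_apply]

theorem cmat_opA_mulVec (A : Matrix (Fin dA) (Fin dA) ℂ) (φ : Fin dA × Fin dB → ℂ) :
    cmat (opA dB A *ᵥ φ) = A * cmat φ := by
  rw [opA_mulVec]
  rfl

theorem cmat_opB_mulVec (B : Matrix (Fin dB) (Fin dB) ℂ) (φ : Fin dA × Fin dB → ℂ) :
    cmat (opB dA B *ᵥ φ) = cmat φ * Bᵀ := by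
  rw [opB_mulVec]
  ext i j
  simp [cmat, actB, mul_apply, mul_comm]

theorem cmat_injective : Function.Injective (cmat : (Fin dA × Fin dB → ℂ) → _) := fun _ _ h =>
  funext fun p => congrFun (congrFun h p.1) p.2

theorem opB_mul_opA (A : Matrix (Fin dA) (Fin dA) ℂ) (B : Matrix (Fin dB) (Fin dB) ℂ) :
    opB dA B * opA dB A = opA dB A * opB dA B := by
  simp [← mul_kronecker_mul]

theorem opA_mul (A A' : Matrix (Fin dA) (Fin dA) ℂ) :
    opA dB A * opA dB A' = opA dB (A * A') := by
  simp [← mul_kronecker_mul]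

theorem opB_mul (B B' : Matrix (Fin dB) (Fin dB) ℂ) :
    opB dA B * opB dA B' = opB dA (B * B') := by
  simp [← mul_kronecker_mul]

theorem conjTranspose_opA (A : Matrix (Fin dA) (Fin dA) ℂ) : (opA dB A)ᴴ = opA dB Aᴴ := by
  simp [conjTranspose_kronecker]

theorem conjTranspose_opB (B : Matrix (Fin dB) (Fin dB) ℂ) : (opB dA B)ᴴ = opB dA Bᴴ := by
  simp [conjTranspose_kronecker]

theorem opA_add (A A' : Matrix (Fin dA) (Fin dA) ℂ) :
    opA dB (A + A') = opA dB A + opA dB A' := add_kronecker _ _ _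

theorem opA_sub (A A' : Matrix (Fin dA) (Fin dA) ℂ) :
    opA dB (A - A') = opA dB A - opA dB A' := by
  ext; simp [sub_mul]

theorem opA_one : opA dB (1 : Matrix (Fin dA) (Fin dA) ℂ) = 1 := one_kronecker_one

theorem opB_add (B B' : Matrix (Fin dB) (Fin dB) ℂ) :
    opB dA (B + B') = opB dA B + opB dA B' := kronecker_add _ _ _

theorem opB_sub (B B' : Matrix (Fin dB) (Fin dB) ℂ) :
    opB dA (B - B') = opB dA B - opB dA B' := by
  ext; simp [mul_sub]

theorem opB_one : opB dA (1 : Matrix (Fin dB) (Fin dB) ℂ) = 1 := one_kronecker_one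

theorem opB_smul (r : ℝ) (B : Matrix (Fin dB) (Fin dB) ℂ) :
    opB dA (r • B) = r • opB dA B := kronecker_smul _ _ _

/-- In a strategy saturating the tilted CHSH inequality, Alice's `-1` component of the state has at
least the Schmidt rank of her `+1` component. -/
theorem tilted_rank_le {φ : Fin dA × Fin dB → ℂ} {A₀ A₁ : Matrix (Fin dA) (Fin dA) ℂ}
    {B₀ B₁ : Matrix (Fin dB) (Fin dB) ℂ} {k s c N : ℝ}
    (hA₀ : A₀ᴴ = A₀) (hA₁ : A₁ᴴ = A₁) (hB₀ : B₀ᴴ = B₀) (hB₁ : B₁ᴴ = B₁)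
    (sqA₀ : A₀ * A₀ = 1) (sqA₁ : A₁ * A₁ = 1) (sqB₀ : B₀ * B₀ = 1) (sqB₁ : B₁ * B₁ = 1)
    (hks : k ^ 2 + s ^ 2 = 1) (hcs : c ^ 2 * (1 + s ^ 2) = 1) (hs : s ≠ 0)
    (e1 : expect φ 1 = N) (eA₀ : expect φ (opA dB A₀) = k * N)
    (eB₀ : expect φ (opB dA B₀) = c * k * N) (eB₁ : expect φ (opB dA B₁) = c * k * N)
    (e₀₀ : expect φ (opA dB A₀ * opB dA B₀) = c * N)
    (e₀₁ : expect φ (opA dB A₀ * opB dA B₁) = c * N)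
    (e₁₀ : expect φ (opA dB A₁ * opB dA B₀) = s * (c * s) * N)
    (e₁₁ : expect φ (opA dB A₁ * opB dA B₁) = -(s * (c * s) * N)) :
    ((1 + A₀) * cmat φ).rank ≤ ((1 - A₀) * cmat φ).rank := by
  have hc : c ≠ 0 := by rintro rfl; simp at hcs
  have hZ : opB dA ((2 * c)⁻¹ • (B₀ + B₁)) = (2 * c)⁻¹ • (opB dA B₀ + opB dA B₁) := by
    rw [opB_smul, opB_add]
  have hX : opB dA ((2 * c * s)⁻¹ • (B₀ - B₁)) = (2 * c * s)⁻¹ • (opB dA B₀ - opB dA B₁) := by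
    rw [opB_smul, opB_sub]
  have sqB₀' : opB dA B₀ * opB dA B₀ = 1 := by rw [opB_mul, sqB₀, opB_one]
  have sqB₁' : opB dA B₁ * opB dA B₁ = 1 := by rw [opB_mul, sqB₁, opB_one]
  have main := tilted_rigidity (φ := φ) (A₀ := opA dB A₀) (A₁ := opA dB A₁)
    (X := opB dA ((2 * c * s)⁻¹ • (B₀ - B₁))) (Z := opB dA ((2 * c)⁻¹ • (B₀ + B₁)))
    (k := k) (s := s) (N := N)
    (by rw [conjTranspose_opA, hA₀]) (by rw [conjTranspose_opA, hA₁])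
    (by rw [conjTranspose_opB, conjTranspose_smul, conjTranspose_sub, hB₀, hB₁, star_trivial])
    (by rw [conjTranspose_opB, conjTranspose_smul, conjTranspose_add, hB₀, hB₁, star_trivial])
    (by rw [opA_mul, sqA₀, opA_one]) (by rw [opA_mul, sqA₁, opA_one])
    (opB_mul_opA _ _) (opB_mul_opA _ _) (opB_mul_opA _ _) (opB_mul_opA _ _)
    (by
      rw [hZ, hX]
      simp only [mul_add, mul_sub, add_mul, sub_mul, smul_mul_assoc, mul_smul_comm, sqB₀', sqB₁']
      module)
    (by
      rw [hZ, hX]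
      simp only [mul_add, mul_sub, add_mul, sub_mul, smul_mul_assoc, mul_smul_comm, sqB₀', sqB₁']
      match_scalars
      · field_simp
        linear_combination (-4 : ℝ) * hcs
      · field_simp
        ring
      · field_simp
        ring)
    hks hs e1 eA₀
    (by
      rw [hZ, map_smul, map_add, eB₀, eB₁, smul_eq_mul]
      field_simp
      ring)
    (by
      rw [hZ, mul_smul_comm, mul_add, map_smul, map_add, e₀₀, e₀₁, smul_eq_mul]
      field_simp
      ring)
    (by
      rw [hX, mul_smul_comm, mul_sub, map_smul, map_sub, e₁₀, e₁₁, smul_eq_mul]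
      field_simp
      ring)
  set X := (2 * c * s)⁻¹ • (B₀ - B₁)
  have hsub : 1 - opA dB A₀ = opA dB (1 - A₀) := by rw [opA_sub, opA_one]
  have hadd : 1 + opA dB A₀ = opA dB (1 + A₀) := by rw [opA_add, opA_one]
  have h : (1 + k) • ((1 - A₀) * cmat φ * Xᵀ) = s • (A₁ * ((1 + A₀) * cmat φ)) := by
    have := congrArg cmat main
    rw [hsub, hadd, ← mulVec_mulVec, ← mulVec_mulVec] at this
    rw [← cmat_opA_mulVec, ← cmat_opA_mulVec, ← cmat_opA_mulVec, ← cmat_opB_mulVec]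
    exact this
  have h' : (1 + A₀) * cmat φ = (s⁻¹ * (1 + k)) • A₁ * ((1 - A₀) * cmat φ) * Xᵀ := by
    rw [Matrix.smul_mul, Matrix.smul_mul, mul_smul, Matrix.mul_assoc A₁, ← Matrix.mul_smul, h,
      Matrix.mul_smul,
      inv_smul_smul₀ hs, ← Matrix.mul_assoc, sqA₁, Matrix.one_mul]
  rw [h']
  exact (rank_mul_le_left _ _).trans (rank_mul_le_right _ _)

end Tensor

section Ideal

/-- The block-diagonal `ℕ × ℕ` matrix repeating `O` on the blocks `{2m + d, 2m + d + 1}`. -/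
def blk (d : ℕ) (O : Matrix (Fin 2) (Fin 2) ℝ) : Matrix ℕ ℕ ℝ :=
  sumB fun m => embed (fun r => 2 * m + d + (r : ℕ)) O

theorem blk_apply (d : ℕ) (O : Matrix (Fin 2) (Fin 2) ℝ) (m : ℕ) (r s : Fin 2) :
    blk d O (2 * m + d + r) (2 * m + d + s) = O r s := by
  rw [blk, sumB, tsum_eq_single m]
  · fin_cases r <;> fin_cases s <;> simp [embed, Fin.sum_univ_two]
  · intro m' hm
    refine Finset.sum_eq_zero fun r' _ => Finset.sum_eq_zero fun s' _ => if_neg fun h => hm ?_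
    have h1 : 2 * m + d + r = 2 * m' + d + r' := h.1
    omega

theorem blk_eq_zero {d : ℕ} {i k : ℕ}
    (h : ¬ ∃ m, ∃ r s : Fin 2, i = 2 * m + d + r ∧ k = 2 * m + d + s)
    (O : Matrix (Fin 2) (Fin 2) ℝ) : blk d O i k = 0 := by
  have (m : ℕ) : embed (fun r => 2 * m + d + (r : ℕ)) O i k = 0 :=
    Finset.sum_eq_zero fun r _ => Finset.sum_eq_zero fun s _ =>
      if_neg fun h' => h ⟨m, r, s, h'⟩
  rw [blk, sumB, tsum_congr this, tsum_zero]

theorem E00_mul_blk_one (O : Matrix (Fin 2) (Fin 2) ℝ) (i k : ℕ) : E00 i k * blk 1 O i k = 0 := by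
  by_cases h : i = 0 ∧ k = 0
  · rw [blk_eq_zero (by omega), mul_zero]
  · simp [E00, h]

theorem pl_sz : pl sz = !![1, 0; 0, 0] := by
  ext i j; fin_cases i <;> fin_cases j <;> norm_num [pl, sz]

theorem mn_sz : mn sz = !![0, 0; 0, 1] := by
  ext i j; fin_cases i <;> fin_cases j <;> norm_num [mn, sz]

theorem blk_pl_sz_mul_blk_mn_sz (d i k : ℕ) : blk d (pl sz) i k * blk d (mn sz) i k = 0 := by
  by_cases h : ∃ m, ∃ r s : Fin 2, i = 2 * m + d + r ∧ k = 2 * m + d + s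
  · obtain ⟨m, r, s, rfl, rfl⟩ := h
    rw [blk_apply, blk_apply, pl_sz, mn_sz]
    fin_cases r <;> fin_cases s <;> simp
  · rw [blk_eq_zero h, zero_mul]

theorem blk_one_pl_sz : blk 1 (pl sz) = blk 0 (mn sz) := by
  ext i k
  by_cases h : i = k ∧ i % 2 = 1
  · obtain ⟨rfl, hi⟩ := h
    obtain ⟨m, rfl⟩ : ∃ m, i = 2 * m + 1 := ⟨i / 2, by omega⟩
    have h1 := blk_apply 1 (pl sz) m 0 0
    have h2 := blk_apply 0 (mn sz) m 1 1
    simp only [Fin.val_zero, Fin.val_one, add_zero] at h1 h2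
    rw [h1, h2, pl_sz, mn_sz]
    simp
  · trans 0
    · by_cases h' : ∃ m, ∃ r s : Fin 2, i = 2 * m + 1 + r ∧ k = 2 * m + 1 + s
      · obtain ⟨m, r, s, rfl, rfl⟩ := h'
        rw [blk_apply, pl_sz]
        fin_cases r <;> fin_cases s <;> simp at h ⊢
      · exact blk_eq_zero h' _
    · symm
      by_cases h' : ∃ m, ∃ r s : Fin 2, i = 2 * m + 0 + r ∧ k = 2 * m + 0 + s
      · obtain ⟨m, r, s, rfl, rfl⟩ := h'
        rw [blk_apply, mn_sz]
        fin_cases r <;> fin_cases s <;> simp at h ⊢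
      · exact blk_eq_zero h' _

/-- The correlation of two real observables in the state with Schmidt coefficients proportional
to `1` and `α`. -/
def qubitCorr (α : ℝ) (O O' : Matrix (Fin 2) (Fin 2) ℝ) : ℝ :=
  (O 0 0 * O' 0 0 + α * (O 0 1 * O' 0 1) + α * (O 1 0 * O' 1 0) + α ^ 2 * (O 1 1 * O' 1 1))
    / (1 + α ^ 2)

theorem tsum_blk {α : ℝ} (hα0 : 0 < α) (hα1 : α < 1) (d : ℕ) (O O' : Matrix (Fin 2) (Fin 2) ℝ) :
    (1 - α ^ 2) * ∑' ik : ℕ × ℕ, α ^ (ik.1 + ik.2) * blk d O ik.1 ik.2 * blk d O' ik.1 ik.2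
      = α ^ (2 * d) * qubitCorr α O O' := by
  let g : ℕ × (Fin 2 × Fin 2) → ℕ × ℕ := fun p => (2 * p.1 + d + p.2.1, 2 * p.1 + d + p.2.2)
  have hg : Function.Injective g := by
    rintro ⟨m, r, s⟩ ⟨m', r', s'⟩ h
    simp only [g, Prod.mk.injEq] at h ⊢
    refine ⟨?_, Fin.ext ?_, Fin.ext ?_⟩ <;> omega
  have hα4 : α ^ 4 < 1 := pow_lt_one₀ hα0.le hα1 (by norm_num)
  have hsum := (summable_geometric_of_lt_one (pow_nonneg hα0.le 4) hα4)
  let w : Fin 2 × Fin 2 → ℝ := fun p => α ^ (2 * d) * (α ^ (p.1 + p.2 : ℕ) * O p.1 p.2 * O' p.1 p.2)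
  rw [← hg.tsum_eq]
  · have key (p : ℕ × (Fin 2 × Fin 2)) :
        α ^ ((g p).1 + (g p).2) * blk d O (g p).1 (g p).2 * blk d O' (g p).1 (g p).2
          = (α ^ 4) ^ p.1 * w p.2 := by
      simp only [g, w, blk_apply]
      ring
    rw [tsum_congr key, ← tsum_mul_tsum_of_summable_norm hsum.norm (g := w) Summable.of_finite,
      tsum_geometric_of_lt_one (pow_nonneg hα0.le 4) hα4, tsum_fintype, Fintype.sum_prod_type]
    have h1 : 1 - α ^ 4 ≠ 0 := by linarith
    have h2 : 1 + α ^ 2 ≠ 0 := by positivity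
    simp only [Fin.sum_univ_two, qubitCorr, w, Fin.val_zero, Fin.val_one]
    field_simp
    ring
  · intro ik hik
    by_contra h
    refine hik ?_
    dsimp only
    rw [blk_eq_zero, mul_zero, zero_mul]
    rintro ⟨m, r, s, h1, h2⟩
    exact h ⟨(m, r, s), Prod.ext h1.symm h2.symm⟩

theorem pstar_blk {α : ℝ} (hα0 : 0 < α) (hα1 : α < 1) {x : Fin 4} {y : Fin 5} {a b : Fin 3}
    {d : ℕ} {O O' : Matrix (Fin 2) (Fin 2) ℝ} (hA : Aop x a = blk d O) (hB : Bop α y b = blk d O') :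
    pstar α x y a b = α ^ (2 * d) * qubitCorr α O O' := by
  rw [pstar, hA, hB, tsum_blk hα0 hα1]

theorem pstar_eq_zero {α : ℝ} {x : Fin 4} {y : Fin 5} {a b : Fin 3} {A B : Matrix ℕ ℕ ℝ}
    (hA : Aop x a = A) (hB : Bop α y b = B) (h : ∀ i k, A i k * B i k = 0) :
    pstar α x y a b = 0 := by
  simp only [pstar, mul_assoc, hA, hB, h, mul_zero, tsum_zero]

theorem pstar_two_two (α : ℝ) : pstar α 2 2 2 2 = 1 - α ^ 2 := by
  have hA : Aop 2 2 = E00 := rfl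
  have hB : Bop α 2 2 = E00 := rfl
  rw [pstar, hA, hB, tsum_eq_single (0, 0)]
  · simp [E00]
  · intro ik h
    have : ¬ (ik.1 = 0 ∧ ik.2 = 0) := fun h' => h (Prod.ext h'.1 h'.2)
    simp [E00, this]

end Ideal

section Values

theorem pl_add_mn (O : Matrix (Fin 2) (Fin 2) ℝ) : pl O + (1 : ℝ) • mn O = 1 := by
  rw [pl, mn]
  module

theorem pl_sub_mn (O : Matrix (Fin 2) (Fin 2) ℝ) : pl O + (-1 : ℝ) • mn O = O := by
  rw [pl, mn]
  module

theorem sin_two_arctan (α : ℝ) : Real.sin (2 * Real.arctan α) = 2 * α / (1 + α ^ 2) := by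
  have h : √(1 + α ^ 2) ^ 2 = 1 + α ^ 2 := Real.sq_sqrt (by positivity)
  rw [Real.sin_two_mul, Real.sin_arctan, Real.cos_arctan]
  field_simp
  rw [h]

theorem cos_mu_sq (α : ℝ) :
    Real.cos (mu α) ^ 2 * (1 + Real.sin (2 * Real.arctan α) ^ 2) = 1 := by
  have h := Real.cos_sq_arctan (Real.sin (2 * Real.arctan α))
  rw [mu, h]
  have : 1 + Real.sin (2 * Real.arctan α) ^ 2 ≠ 0 := by positivity
  field_simp

theorem sin_mu (α : ℝ) :
    Real.sin (mu α) = Real.cos (mu α) * Real.sin (2 * Real.arctan α) := by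
  rw [mu, Real.sin_arctan, Real.cos_arctan]
  ring

theorem qubitCorr_one_one (α : ℝ) : qubitCorr α 1 1 = 1 := by
  have : 1 + α ^ 2 ≠ 0 := by positivity
  simp [qubitCorr, this]

theorem qubitCorr_sz_one (α : ℝ) : qubitCorr α sz 1 = (1 - α ^ 2) / (1 + α ^ 2) := by
  simp [qubitCorr, sz, sub_eq_add_neg]

theorem qubitCorr_one_saz (α : ℝ) :
    qubitCorr α 1 (saz α) = Real.cos (mu α) * ((1 - α ^ 2) / (1 + α ^ 2)) := by
  simp [qubitCorr, saz, sz, sx]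
  ring

theorem qubitCorr_one_sax (α : ℝ) :
    qubitCorr α 1 (sax α) = Real.cos (mu α) * ((1 - α ^ 2) / (1 + α ^ 2)) := by
  simp [qubitCorr, sax, sz, sx]
  ring

theorem qubitCorr_sz_saz (α : ℝ) : qubitCorr α sz (saz α) = Real.cos (mu α) := by
  have : 1 + α ^ 2 ≠ 0 := by positivity
  simp [qubitCorr, saz, sz, sx]
  field_simp

theorem qubitCorr_sz_sax (α : ℝ) : qubitCorr α sz (sax α) = Real.cos (mu α) := by
  have : 1 + α ^ 2 ≠ 0 := by positivity
  simp [qubitCorr, sax, sz, sx]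
  field_simp

theorem qubitCorr_sx_saz (α : ℝ) : qubitCorr α sx (saz α)
    = Real.sin (2 * Real.arctan α) * (Real.cos (mu α) * Real.sin (2 * Real.arctan α)) := by
  rw [← sin_mu, sin_two_arctan]
  simp [qubitCorr, saz, sz, sx]
  ring

theorem qubitCorr_sx_sax (α : ℝ) : qubitCorr α sx (sax α)
    = -(Real.sin (2 * Real.arctan α) * (Real.cos (mu α) * Real.sin (2 * Real.arctan α))) := by
  rw [← sin_mu, sin_two_arctan]
  simp [qubitCorr, sax, sz, sx]
  ring

theorem qubitCorr_add_smul (α ε δ : ℝ) (O₁ O₂ O₁' O₂' : Matrix (Fin 2) (Fin 2) ℝ) :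
    qubitCorr α (O₁ + ε • O₂) (O₁' + δ • O₂')
      = qubitCorr α O₁ O₁' + δ * qubitCorr α O₁ O₂' + ε * qubitCorr α O₂ O₁'
        + ε * δ * qubitCorr α O₂ O₂' := by
  simp only [qubitCorr, Matrix.add_apply, Matrix.smul_apply, smul_eq_mul]
  ring

end Values

section Rank

theorem rank_smul_of_ne_zero {m n : Type*} [Fintype n] {c : ℂ} (hc : c ≠ 0) (A : Matrix m n ℂ) :
    (c • A).rank = A.rank :=
  rank_smul_of_mem_nonZeroDivisors A (by simpa using hc)

/-- If `q` is idempotent with `q * p = 0`, and left multiplication of `W` by `p` and by `q` can be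
realized by right multiplications, then `p * W` has smaller rank than `W` unless `q * W = 0`. -/
theorem rank_lt_rank {m n : Type*} [Fintype m] [Fintype n] [DecidableEq n] {p q : Matrix m m ℂ}
    {W : Matrix m n ℂ} {R R' : Matrix n n ℂ} (hqp : q * p = 0) (hqq : q * q = q)
    (hp : p * W = W * R) (hq : q * W = W * R') (h0 : q * W ≠ 0) : (p * W).rank < W.rank := by
  refine lt_of_le_of_ne (hp ▸ rank_mul_le_left W R) fun h => h0 ?_
  have hle : LinearMap.range (p * W).mulVecLin ≤ LinearMap.range W.mulVecLin := by
    rw [hp, mulVecLin_mul]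
    exact LinearMap.range_comp_le_range _ _
  have hrange := Submodule.eq_of_le_of_finrank_eq hle h
  apply Matrix.ext_of_mulVec_single
  intro i
  obtain ⟨v, hv⟩ : (q * W) *ᵥ Pi.single i 1 ∈ LinearMap.range (p * W).mulVecLin := by
    rw [hrange, hq, ← mulVec_mulVec]
    exact ⟨_, rfl⟩
  have h1 := congrArg (q *ᵥ ·) hv
  simp only [mulVecLin_apply, mulVec_mulVec, ← Matrix.mul_assoc, hqp, hqq, Matrix.zero_mul,
    zero_mulVec] at h1
  rw [← h1, zero_mulVec]

end Rank

section Strategy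

theorem mul_eq_zero_of_idempotent {n : Type*} [Fintype n] [DecidableEq n] {p q : Matrix n n ℂ}
    (hp : p * p = p) (hq : q * q = q) (hpq : (1 - p - q) * (1 - p - q) = 1 - p - q) :
    p * q = 0 := by
  have h : p * q + q * p = 0 := by
    simp only [mul_sub, sub_mul, mul_one, one_mul, hp, hq] at hpq
    linear_combination (norm := noncomm_ring) hpq
  have h1 : p * q + p * q * p = 0 := by
    simpa only [mul_add, ← mul_assoc, hp, mul_zero] using congrArg (p * ·) h
  have h2 : p * q * p + q * p = 0 := by
    simpa only [add_mul, mul_assoc, hp, zero_mul] using congrArg (· * p) h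
  have h3 : (2 : ℂ) • (p * q) = 0 := by
    rw [two_smul]
    linear_combination (norm := noncomm_ring) h + h1 - h2
  exact (smul_eq_zero.mp h3).resolve_left two_ne_zero

theorem mul_eq_zero_of_complete {n : Type*} [Fintype n] [DecidableEq n] {P : Fin 3 → Matrix n n ℂ}
    (hproj : ∀ a, P a * P a = P a) (hsum : ∑ a, P a = 1) {a b : Fin 3} (hab : a ≠ b) :
    P a * P b = 0 := by
  obtain ⟨c, hc⟩ : ∃ c, 1 - P a - P b = P c := by
    rw [Fin.sum_univ_three] at hsum
    rw [← hsum]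
    fin_cases a <;> fin_cases b <;> first | exact absurd rfl hab | skip
    · exact ⟨2, by dsimp; abel⟩
    · exact ⟨1, by dsimp; abel⟩
    · exact ⟨2, by dsimp; abel⟩
    · exact ⟨0, by dsimp; abel⟩
    · exact ⟨1, by dsimp; abel⟩
    · exact ⟨0, by dsimp; abel⟩
  exact mul_eq_zero_of_idempotent (hproj a) (hproj b) (by rw [hc, hproj])

variable {dA dB : ℕ} {S : Strategy dA dB} {α : ℝ}

theorem expect_opA_mul_opB (hind : ∀ x y a b, induced S x y a b = (pstar α x y a b : ℂ))
    (x : Fin 4) (y : Fin 5) (a b : Fin 3) :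
    expect S.ψ (opA dB (S.P x a) * opB dA (S.Q y b)) = pstar α x y a b := by
  change (star S.ψ ⬝ᵥ (opA dB (S.P x a) * opB dA (S.Q y b)) *ᵥ S.ψ).re = _
  rw [← mulVec_mulVec, opA_mulVec, opB_mulVec, ← Complex.ofReal_re (pstar α x y a b), ← hind]
  rfl

theorem sum_opA_P (S : Strategy dA dB) (x : Fin 4) : ∑ a, opA dB (S.P x a) = 1 := by
  rw [← opA_one, ← S.P_complete x, Fin.sum_univ_three, Fin.sum_univ_three, opA_add, opA_add]

theorem sum_opB_Q (S : Strategy dA dB) (y : Fin 5) : ∑ b, opB dA (S.Q y b) = 1 := by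
  rw [← opB_one, ← S.Q_complete y, Fin.sum_univ_three, Fin.sum_univ_three, opB_add, opB_add]

/-- Perfectly correlated answers are given by the same projection of the state. -/
theorem opA_mulVec_eq_opB_mulVec (hind : ∀ x y a b, induced S x y a b = (pstar α x y a b : ℂ))
    {x : Fin 4} {y : Fin 5} {a b : Fin 3} (hb : ∀ b', b' ≠ b → pstar α x y a b' = 0)
    (ha : ∀ a', a' ≠ a → pstar α x y a' b = 0) :
    opA dB (S.P x a) *ᵥ S.ψ = opB dA (S.Q y b) *ᵥ S.ψ := by
  have eA : expect S.ψ (opA dB (S.P x a)) = pstar α x y a b := by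
    rw [← mul_one (opA dB _), ← sum_opB_Q S y, Finset.mul_sum, map_sum]
    simp only [expect_opA_mul_opB hind]
    exact Finset.sum_eq_single b (fun b' _ h => hb b' h) (by simp)
  have eB : expect S.ψ (opB dA (S.Q y b)) = pstar α x y a b := by
    rw [← one_mul (opB dA _), ← sum_opA_P S x, Finset.sum_mul, map_sum]
    simp only [expect_opA_mul_opB hind]
    exact Finset.sum_eq_single a (fun a' _ h => ha a' h) (by simp)
  rw [← sub_eq_zero, ← sub_mulVec]
  apply mulVec_eq_zero_of_expect
  rw [conjTranspose_sub, conjTranspose_opA, conjTranspose_opB, S.P_sa, S.Q_sa, mul_sub, sub_mul,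
    sub_mul, opA_mul, opB_mul, S.P_proj, S.Q_proj, opB_mul_opA, map_sub, map_sub, map_sub, eA, eB,
    expect_opA_mul_opB hind]
  ring

theorem reflection {n : Type*} [Fintype n] [DecidableEq n] {p : Matrix n n ℂ} (hp : p * p = p) :
    (1 - (2 : ℝ) • p) * (1 - (2 : ℝ) • p) = 1 := by
  simp only [mul_sub, sub_mul, mul_one, one_mul, smul_mul_assoc, mul_smul_comm, hp]
  module

theorem rank_le_of_tilted (hind : ∀ x y a b, induced S x y a b = (pstar α x y a b : ℂ))
    (hα0 : 0 < α) (hα1 : α < 1) {i j : Fin 3} (hij : i = 0 ∧ j = 1 ∨ i = 1 ∧ j = 0)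
    {x₀ x₁ : Fin 4} {y₀ y₁ : Fin 5} {d : ℕ}
    (hA₀ : Aop x₀ i = blk d (pl sz)) (hA₀' : Aop x₀ j = blk d (mn sz))
    (hA₁ : Aop x₁ i = blk d (pl sx)) (hA₁' : Aop x₁ j = blk d (mn sx))
    (hB₀ : Bop α y₀ i = blk d (pl (saz α))) (hB₀' : Bop α y₀ j = blk d (mn (saz α)))
    (hB₁ : Bop α y₁ i = blk d (pl (sax α))) (hB₁' : Bop α y₁ j = blk d (mn (sax α)))
    (hx : opA dB (S.P x₁ 2) *ᵥ S.ψ = opA dB (S.P x₀ 2) *ᵥ S.ψ)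
    (hy₀ : opB dA (S.Q y₀ 2) *ᵥ S.ψ = opA dB (S.P x₀ 2) *ᵥ S.ψ)
    (hy₁ : opB dA (S.Q y₁ 2) *ᵥ S.ψ = opA dB (S.P x₀ 2) *ᵥ S.ψ) :
    (S.P x₀ i * cmat S.ψ).rank ≤ (S.P x₀ j * cmat S.ψ).rank := by
  have hne : i ≠ j := by rcases hij with ⟨rfl, rfl⟩ | ⟨rfl, rfl⟩ <;> decide
  have complete {n : Type} [Fintype n] [DecidableEq n] {P : Fin 3 → Matrix n n ℂ}
      (h : ∑ a, P a = 1) : P i + P j = 1 - P 2 := by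
    rw [← h, Fin.sum_univ_three]
    rcases hij with ⟨rfl, rfl⟩ | ⟨rfl, rfl⟩ <;> abel
  set φ : Fin dA × Fin dB → ℂ := S.ψ - opA dB (S.P x₀ 2) *ᵥ S.ψ with hφ
  have stateA {x : Fin 4} (h : opA dB (S.P x 2) *ᵥ S.ψ = opA dB (S.P x₀ 2) *ᵥ S.ψ) :
      φ = opA dB (S.P x i + S.P x j) *ᵥ S.ψ := by
    rw [complete (S.P_complete x), opA_sub, sub_mulVec, h, opA_one, one_mulVec]
  have stateB {y : Fin 5} (h : opB dA (S.Q y 2) *ᵥ S.ψ = opA dB (S.P x₀ 2) *ᵥ S.ψ) :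
      φ = opB dA (S.Q y i + S.Q y j) *ᵥ S.ψ := by
    rw [complete (S.Q_complete y), opB_sub, sub_mulVec, h, opB_one, one_mulVec]
  have refl {n : Type} [Fintype n] [DecidableEq n] {P : Fin 3 → Matrix n n ℂ}
      (hp : ∀ a, P a * P a = P a) (h : ∑ a, P a = 1) :
      (1 - (2 : ℝ) • P j) * (P i + P j) = P i + (-1 : ℝ) • P j := by
    rw [mul_add, sub_mul, sub_mul, smul_mul_assoc, smul_mul_assoc, hp,
      mul_eq_zero_of_complete hp h hne.symm, one_mul, one_mul]
    module
  have actA_refl {x : Fin 4} (h : opA dB (S.P x 2) *ᵥ S.ψ = opA dB (S.P x₀ 2) *ᵥ S.ψ) :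
      opA dB (1 - (2 : ℝ) • S.P x j) *ᵥ φ = opA dB (S.P x i + (-1 : ℝ) • S.P x j) *ᵥ S.ψ := by
    rw [stateA h, mulVec_mulVec, opA_mul, refl (S.P_proj x) (S.P_complete x)]
  have actB_refl {y : Fin 5} (h : opB dA (S.Q y 2) *ᵥ S.ψ = opA dB (S.P x₀ 2) *ᵥ S.ψ) :
      opB dA (1 - (2 : ℝ) • S.Q y j) *ᵥ φ = opB dA (S.Q y i + (-1 : ℝ) • S.Q y j) *ᵥ S.ψ := by
    rw [stateB h, mulVec_mulVec, opB_mul, refl (S.Q_proj y) (S.Q_complete y)]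
  have actA_one {x : Fin 4} (h : opA dB (S.P x 2) *ᵥ S.ψ = opA dB (S.P x₀ 2) *ᵥ S.ψ) :
      (1 : Matrix (Fin dA × Fin dB) (Fin dA × Fin dB) ℂ) *ᵥ φ
        = opA dB (S.P x i + (1 : ℝ) • S.P x j) *ᵥ S.ψ := by
    rw [one_mulVec, one_smul, ← stateA h]
  have actB_one {y : Fin 5} (h : opB dA (S.Q y 2) *ᵥ S.ψ = opA dB (S.P x₀ 2) *ᵥ S.ψ) :
      (1 : Matrix (Fin dA × Fin dB) (Fin dA × Fin dB) ℂ) *ᵥ φ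
        = opB dA (S.Q y i + (1 : ℝ) • S.Q y j) *ᵥ S.ψ := by
    rw [one_mulVec, one_smul, ← stateB h]
  have saA (x : Fin 4) : (1 - (2 : ℝ) • S.P x j)ᴴ = 1 - (2 : ℝ) • S.P x j := by
    rw [conjTranspose_sub, conjTranspose_smul, conjTranspose_one, star_trivial, S.P_sa]
  have saB (y : Fin 5) : (1 - (2 : ℝ) • S.Q y j)ᴴ = 1 - (2 : ℝ) • S.Q y j := by
    rw [conjTranspose_sub, conjTranspose_smul, conjTranspose_one, star_trivial, S.Q_sa]
  have corr {x : Fin 4} {y : Fin 5} {O O' : Matrix (Fin 2) (Fin 2) ℝ}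
      (hA : Aop x i = blk d (pl O)) (hA' : Aop x j = blk d (mn O))
      (hB : Bop α y i = blk d (pl O')) (hB' : Bop α y j = blk d (mn O')) (ε δ : ℝ)
      {T U : Matrix (Fin dA × Fin dB) (Fin dA × Fin dB) ℂ} (hTsa : Tᴴ = T)
      (hT : T *ᵥ φ = opA dB (S.P x i + ε • S.P x j) *ᵥ S.ψ)
      (hU : U *ᵥ φ = opB dA (S.Q y i + δ • S.Q y j) *ᵥ S.ψ) :
      expect φ (T * U) = qubitCorr α (pl O + ε • mn O) (pl O' + δ • mn O') * α ^ (2 * d) := by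
    have hP : (opA dB (S.P x i + ε • S.P x j))ᴴ = opA dB (S.P x i) + ε • opA dB (S.P x j) := by
      rw [conjTranspose_opA, conjTranspose_add, conjTranspose_smul, star_trivial, S.P_sa, S.P_sa,
        opA_add]
      exact congrArg _ (smul_kronecker _ _ _)
    have : expect φ (T * U) = expect S.ψ
        ((opA dB (S.P x i + ε • S.P x j))ᴴ * opB dA (S.Q y i + δ • S.Q y j)) := by
      rw [← hTsa, expect_conjTranspose_mul, expect_conjTranspose_mul, hT, hU]
    rw [this, hP, opB_add, opB_smul, qubitCorr_add_smul]
    simp only [add_mul, mul_add, smul_mul_assoc, mul_smul_comm, map_add, map_smul, smul_eq_mul,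
      expect_opA_mul_opB hind, pstar_blk hα0 hα1 hA hB, pstar_blk hα0 hα1 hA' hB,
      pstar_blk hα0 hα1 hA hB', pstar_blk hα0 hα1 hA' hB']
    ring
  have h := tilted_rank_le (φ := φ) (A₀ := 1 - (2 : ℝ) • S.P x₀ j) (A₁ := 1 - (2 : ℝ) • S.P x₁ j)
    (B₀ := 1 - (2 : ℝ) • S.Q y₀ j) (B₁ := 1 - (2 : ℝ) • S.Q y₁ j)
    (k := (1 - α ^ 2) / (1 + α ^ 2)) (s := Real.sin (2 * Real.arctan α))
    (c := Real.cos (mu α)) (N := α ^ (2 * d))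
    (saA x₀) (saA x₁) (saB y₀) (saB y₁) (reflection (S.P_proj x₀ j)) (reflection (S.P_proj x₁ j))
    (reflection (S.Q_proj y₀ j)) (reflection (S.Q_proj y₁ j))
    (by
      rw [sin_two_arctan]
      field_simp
      ring)
    (cos_mu_sq α)
    (by
      rw [sin_two_arctan]
      positivity)
    (by
      rw [← mul_one 1, corr hA₀ hA₀' hB₀ hB₀' 1 1 conjTranspose_one (actA_one rfl) (actB_one hy₀),
        pl_add_mn, pl_add_mn, qubitCorr_one_one, one_mul])
    (by
      rw [← mul_one (opA dB _), corr hA₀ hA₀' hB₀ hB₀' (-1) 1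
        (by rw [conjTranspose_opA, saA]) (actA_refl rfl) (actB_one hy₀),
        pl_sub_mn, pl_add_mn, qubitCorr_sz_one])
    (by
      rw [← one_mul (opB dA _), corr hA₀ hA₀' hB₀ hB₀' 1 (-1)
        conjTranspose_one (actA_one rfl) (actB_refl hy₀), pl_add_mn, pl_sub_mn, qubitCorr_one_saz])
    (by
      rw [← one_mul (opB dA _), corr hA₀ hA₀' hB₁ hB₁' 1 (-1)
        conjTranspose_one (actA_one rfl) (actB_refl hy₁), pl_add_mn, pl_sub_mn, qubitCorr_one_sax])
    (by
      rw [corr hA₀ hA₀' hB₀ hB₀' (-1) (-1) (by rw [conjTranspose_opA, saA]) (actA_refl rfl)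
        (actB_refl hy₀), pl_sub_mn, pl_sub_mn, qubitCorr_sz_saz])
    (by
      rw [corr hA₀ hA₀' hB₁ hB₁' (-1) (-1) (by rw [conjTranspose_opA, saA]) (actA_refl rfl)
        (actB_refl hy₁), pl_sub_mn, pl_sub_mn, qubitCorr_sz_sax])
    (by
      rw [corr hA₁ hA₁' hB₀ hB₀' (-1) (-1) (by rw [conjTranspose_opA, saA]) (actA_refl hx)
        (actB_refl hy₀), pl_sub_mn, pl_sub_mn, qubitCorr_sx_saz])
    (by
      rw [corr hA₁ hA₁' hB₁ hB₁' (-1) (-1) (by rw [conjTranspose_opA, saA]) (actA_refl hx)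
        (actB_refl hy₁), pl_sub_mn, pl_sub_mn, qubitCorr_sx_sax, neg_mul])
  have hφM : cmat φ = (S.P x₀ i + S.P x₀ j) * cmat S.ψ := by
    rw [stateA rfl, cmat_opA_mulVec]
  have orth' := mul_eq_zero_of_complete (S.P_proj x₀) (S.P_complete x₀) hne.symm
  have plus : (1 + (1 - (2 : ℝ) • S.P x₀ j)) * (S.P x₀ i + S.P x₀ j) = (2 : ℂ) • S.P x₀ i := by
    simp only [mul_add, add_mul, sub_mul, one_mul, smul_mul_assoc, S.P_proj, orth']
    module
  have minus : (1 - (1 - (2 : ℝ) • S.P x₀ j)) * (S.P x₀ i + S.P x₀ j) = (2 : ℂ) • S.P x₀ j := by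
    simp only [mul_add, sub_mul, one_mul, smul_mul_assoc, S.P_proj, orth']
    module
  rwa [hφM, ← Matrix.mul_assoc, ← Matrix.mul_assoc, plus, minus, Matrix.smul_mul, Matrix.smul_mul,
    rank_smul_of_ne_zero two_ne_zero, rank_smul_of_ne_zero two_ne_zero] at h

end Strategy

section Separation

variable {dA dB : ℕ} {S : Strategy dA dB} {α : ℝ}

theorem outcome_two_even (hind : ∀ x y a b, induced S x y a b = (pstar α x y a b : ℂ))
    {x : Fin 4} {y : Fin 5} (hA : Aop x 2 = 0) (hB : Bop α y 2 = 0) :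
    opA dB (S.P x 2) *ᵥ S.ψ = opB dA (S.Q y 2) *ᵥ S.ψ :=
  opA_mulVec_eq_opB_mulVec hind (fun _ _ => pstar_eq_zero hA rfl fun _ _ => zero_mul _)
    (fun _ _ => pstar_eq_zero rfl hB fun _ _ => mul_zero _)

theorem outcome_two_odd (hind : ∀ x y a b, induced S x y a b = (pstar α x y a b : ℂ))
    {x : Fin 4} {y : Fin 5} {O₀ O₁ O₀' O₁' : Matrix (Fin 2) (Fin 2) ℝ}
    (hA₀ : Aop x 0 = blk 1 O₀) (hA₁ : Aop x 1 = blk 1 O₁) (hA : Aop x 2 = E00)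
    (hB₀ : Bop α y 0 = blk 1 O₀') (hB₁ : Bop α y 1 = blk 1 O₁') (hB : Bop α y 2 = E00) :
    opA dB (S.P x 2) *ᵥ S.ψ = opB dA (S.Q y 2) *ᵥ S.ψ := by
  refine opA_mulVec_eq_opB_mulVec hind (fun b hb => ?_) (fun a ha => ?_)
  · obtain rfl | rfl : b = 0 ∨ b = 1 := by omega
    · exact pstar_eq_zero hA hB₀ (E00_mul_blk_one _)
    · exact pstar_eq_zero hA hB₁ (E00_mul_blk_one _)
  · obtain rfl | rfl : a = 0 ∨ a = 1 := by omega
    · exact pstar_eq_zero hA₀ hB fun i k => by rw [mul_comm, E00_mul_blk_one]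
    · exact pstar_eq_zero hA₁ hB fun i k => by rw [mul_comm, E00_mul_blk_one]

theorem outcome_two_zero (hind : ∀ x y a b, induced S x y a b = (pstar α x y a b : ℂ)) :
    opA dB (S.P 0 2) *ᵥ S.ψ = 0 := by
  apply mulVec_eq_zero_of_expect
  rw [expect_congr rfl (outcome_two_even (α := α) (y := 0) hind rfl rfl), conjTranspose_opA, S.P_sa,
    expect_opA_mul_opB hind]
  exact pstar_eq_zero rfl rfl fun _ _ => zero_mul _

theorem outcome_one_zero_four (hind : ∀ x y a b, induced S x y a b = (pstar α x y a b : ℂ)) :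
    opA dB (S.P 0 1) *ᵥ S.ψ = opB dA (S.Q 4 1) *ᵥ S.ψ := by
  refine opA_mulVec_eq_opB_mulVec hind (fun b hb => ?_) (fun a ha => ?_)
  · obtain rfl | rfl : b = 0 ∨ b = 2 := by omega
    · exact pstar_eq_zero (A := blk 0 (mn sz)) (B := blk 0 (pl sz)) rfl rfl
        fun i k => by rw [mul_comm, blk_pl_sz_mul_blk_mn_sz]
    · exact pstar_eq_zero (B := 0) rfl rfl fun _ _ => mul_zero _
  · obtain rfl | rfl : a = 0 ∨ a = 2 := by omega
    · exact pstar_eq_zero (A := blk 0 (pl sz)) (B := blk 0 (mn sz)) rfl rfl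
        fun i k => blk_pl_sz_mul_blk_mn_sz _ _ _
    · exact pstar_eq_zero (A := 0) rfl rfl fun _ _ => zero_mul _

theorem outcome_one_two_four (hind : ∀ x y a b, induced S x y a b = (pstar α x y a b : ℂ)) :
    opA dB (S.P 2 1) *ᵥ S.ψ = opB dA (S.Q 4 1) *ᵥ S.ψ := by
  have hA : Aop 2 1 = blk 0 (mn sz) := blk_one_pl_sz
  have hB : Bop α 4 1 = blk 1 (pl sz) := blk_one_pl_sz.symm
  refine opA_mulVec_eq_opB_mulVec hind (fun b hb => ?_) (fun a ha => ?_)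
  · obtain rfl | rfl : b = 0 ∨ b = 2 := by omega
    · exact pstar_eq_zero (B := blk 0 (pl sz)) hA rfl
        fun i k => by rw [mul_comm, blk_pl_sz_mul_blk_mn_sz]
    · exact pstar_eq_zero (B := 0) rfl rfl fun _ _ => mul_zero _
  · obtain rfl | rfl : a = 0 ∨ a = 2 := by omega
    · exact pstar_eq_zero (A := blk 1 (mn sz)) rfl hB
        fun i k => by rw [mul_comm, blk_pl_sz_mul_blk_mn_sz]
    · exact pstar_eq_zero (A := E00) rfl hB fun i k => E00_mul_blk_one _ _ _

/-- No finite-dimensional strategy induces the ideal correlation. -/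
theorem not_induces_pstar (hα0 : 0 < α) (hα1 : α < 1) (S : Strategy dA dB) :
    ¬ ∀ x y a b, induced S x y a b = (pstar α x y a b : ℂ) := by
  intro hind
  have lift {A A' : Matrix (Fin dA) (Fin dA) ℂ} (h : opA dB A *ᵥ S.ψ = opA dB A' *ᵥ S.ψ) :
      A * cmat S.ψ = A' * cmat S.ψ := by
    rw [← cmat_opA_mulVec, ← cmat_opA_mulVec, h]
  have even : (S.P 0 0 * cmat S.ψ).rank ≤ (S.P 0 1 * cmat S.ψ).rank :=
    rank_le_of_tilted (x₁ := 1) (y₀ := 0) (y₁ := 1) (d := 0) hind hα0 hα1 (by decide)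
      rfl rfl rfl rfl rfl rfl rfl rfl
      ((outcome_two_even hind rfl rfl).trans (outcome_two_even (y := 0) hind rfl rfl).symm)
      (outcome_two_even hind rfl rfl).symm (outcome_two_even hind rfl rfl).symm
  have odd₂₂ := outcome_two_odd (x := 2) (y := 2) hind rfl rfl rfl rfl rfl rfl
  have odd : (S.P 2 1 * cmat S.ψ).rank ≤ (S.P 2 0 * cmat S.ψ).rank :=
    rank_le_of_tilted (x₁ := 3) (y₀ := 2) (y₁ := 3) (d := 1) hind hα0 hα1 (by decide)
      rfl rfl rfl rfl rfl rfl rfl rfl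
      ((outcome_two_odd hind rfl rfl rfl rfl rfl rfl).trans odd₂₂.symm)
      odd₂₂.symm (outcome_two_odd hind rfl rfl rfl rfl rfl rfl).symm
  have h01 : S.P 0 1 * cmat S.ψ = S.P 2 1 * cmat S.ψ :=
    lift ((outcome_one_zero_four hind).trans (outcome_one_two_four hind).symm)
  have h02 : S.P 0 2 * cmat S.ψ = 0 := by
    rw [← cmat_opA_mulVec, outcome_two_zero hind]
    rfl
  have h22 : S.P 2 2 * cmat S.ψ = cmat S.ψ * (S.Q 2 2)ᵀ := by
    rw [← cmat_opA_mulVec, odd₂₂, cmat_opB_mulVec]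
  have hsplit (x : Fin 4) : S.P x 0 * cmat S.ψ + S.P x 1 * cmat S.ψ + S.P x 2 * cmat S.ψ
      = cmat S.ψ := by
    have h := S.P_complete x
    rw [Fin.sum_univ_three] at h
    rw [← Matrix.add_mul, ← Matrix.add_mul, h, Matrix.one_mul]
  have hW : S.P 0 0 * cmat S.ψ = S.P 2 0 * cmat S.ψ + S.P 2 2 * cmat S.ψ := by
    have h := (hsplit 0).trans (hsplit 2).symm
    rw [h01, h02] at h
    linear_combination (norm := abel) h
  have orth {a b : Fin 3} (h : a ≠ b) : S.P 2 a * S.P 2 b = 0 :=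
    mul_eq_zero_of_complete (S.P_proj 2) (S.P_complete 2) h
  have hqW : S.P 2 2 * (S.P 0 0 * cmat S.ψ) = S.P 2 2 * cmat S.ψ := by
    rw [hW, Matrix.mul_add, ← Matrix.mul_assoc, ← Matrix.mul_assoc, orth (by decide), S.P_proj,
      Matrix.zero_mul, zero_add]
  have hpW : S.P 2 0 * (S.P 0 0 * cmat S.ψ) = S.P 2 0 * cmat S.ψ := by
    rw [hW, Matrix.mul_add, ← Matrix.mul_assoc, ← Matrix.mul_assoc, S.P_proj,
      orth (by decide), Matrix.zero_mul, add_zero]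
  have hWR : S.P 0 0 * cmat S.ψ * (S.Q 2 2)ᵀ = S.P 2 2 * cmat S.ψ := by
    rw [hW, Matrix.add_mul, Matrix.mul_assoc, Matrix.mul_assoc, ← h22, ← Matrix.mul_assoc,
      ← Matrix.mul_assoc, orth (by decide), S.P_proj, Matrix.zero_mul, zero_add]
  have h0 : S.P 2 2 * (S.P 0 0 * cmat S.ψ) ≠ 0 := by
    rw [hqW]
    intro h
    have hψ : opA dB (S.P 2 2) *ᵥ S.ψ = 0 := cmat_injective (by rw [cmat_opA_mulVec, h]; rfl)
    have hp := expect_opA_mul_opB hind 2 2 2 2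
    have he : expect S.ψ (opA dB (S.P 2 2) * opB dA (S.Q 2 2)) = 0 := by
      change (star S.ψ ⬝ᵥ _ *ᵥ S.ψ).re = 0
      rw [← opB_mul_opA, ← mulVec_mulVec, hψ, mulVec_zero, dotProduct_zero, Complex.zero_re]
    rw [he, pstar_two_two] at hp
    nlinarith
  have hlt := rank_lt_rank (p := S.P 2 0) (q := S.P 2 2) (W := S.P 0 0 * cmat S.ψ)
    (R := 1 - (S.Q 2 2)ᵀ) (R' := (S.Q 2 2)ᵀ) (orth (by decide)) (S.P_proj 2 2)
    (by rw [hpW, Matrix.mul_sub, Matrix.mul_one, hWR, hW, add_sub_cancel_right])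
    (by rw [hqW, hWR]) h0
  rw [hpW] at hlt
  rw [h01] at even
  exact absurd (even.trans odd) hlt.not_ge

end Separation

end Sep

open Sep in
/-- two incompatible partitions of the Schmidt coefficients. For any
finite-dimensional strategy inducing `p*`, the Schmidt multiset of `ψ` admits multisets
`S₀, S₁, S₂` of positive reals with `S₂` nonempty, `Schmidt(ψ) = S₀ + S₁`,
`S₁ = α·S₀`, and `S₀ = S₂ + α·S₁`. -/
theorem two_incompatible_partitions_of_schmidt
    (α : ℝ) (hα0 : 0 < α) (hα1 : α < 1)
    {dA dB : ℕ} (hdA : 1 ≤ dA) (hdB : 1 ≤ dB) (S : Strategy dA dB)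
    (hind : ∀ x y a b, induced S x y a b = (pstar α x y a b : ℂ)) :
    ∃ S0 S1 S2 : Multiset ℝ,
      (∀ t ∈ S0, 0 < t) ∧ (∀ t ∈ S1, 0 < t) ∧ (∀ t ∈ S2, 0 < t) ∧
      S2 ≠ 0 ∧
      schmidt S.ψ = S0 + S1 ∧
      S1 = S0.map (fun t => α * t) ∧
      S0 = S2 + S1.map (fun t => α * t) := by
  exact absurd hind (not_induces_pstar hα0 hα1 S)
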